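/- arXiv:2012.01670 — 2 statements merged into one kernel-verified Lean document; each statement's English description precedes it below -/
import Mathlib

section
/- Let τ have positive imaginary part, q = exp(2πiτ), θ₁ the first Jacobi theta function, and ℘(z|τ) the Weierstrass elliptic function attached to the lattice {mπ + nπτ}. Then for all x, y not in the lattice: ℘(x|τ) - ℘(y|τ) = -θ₁'(0|τ)² · θ₁(x+y|τ)·θ₁(x-y|τ)/(θ₁(x|τ)²·θ₁(y|τ)²). -/
open Complex

/-- The first Jacobi theta function
`θ₁(z|τ) = 2 ∑_{n≥0} (-1)^n q^{(2n+1)²/8} sin((2n+1)z)` with `q = exp(2πiτ)`,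
so that `q^{(2n+1)²/8} = exp(π i τ (2n+1)²/4)`. -/
noncomputable def theta1 (z τ : ℂ) : ℂ :=
  2 * ∑' n : ℕ, (-1 : ℂ) ^ n *
    Complex.exp (Real.pi * Complex.I * τ * (2 * n + 1) ^ 2 / 4) *
    Complex.sin ((2 * n + 1) * z)

/-- The `z`-derivative of the first Jacobi theta function. -/
noncomputable def theta1' (z τ : ℂ) : ℂ := deriv (fun w => theta1 w τ) z

/-- A point of the lattice `{mπ + nπτ}`. -/
noncomputable def latticePt (τ : ℂ) (p : ℤ × ℤ) : ℂ :=
  p.1 * Real.pi + p.2 * Real.pi * τ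

/-- The Weierstrass elliptic function attached to the lattice `{mπ + nπτ}`. -/
noncomputable def wp (τ z : ℂ) : ℂ :=
  1 / z ^ 2 + ∑' p : {p : ℤ × ℤ // p ≠ 0},
    (1 / (z - latticePt τ p.1) ^ 2 - 1 / latticePt τ p.1 ^ 2)

open Filter Topology

/-- Entire functions with the quasi-periodicity of a theta function of order two. -/
structure IsOrderTwoTheta (τ : ℂ) (F : ℂ → ℂ) : Prop where
  differentiable : Differentiable ℂ F
  add_pi : ∀ z, F (z + Real.pi) = F z
  add_pi_mul : ∀ z, F (z + Real.pi * τ) = exp (-2 * Real.pi * I * τ - 4 * I * z) * F z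

/-- The (unnormalised) Fourier coefficients of a `π`-periodic function. -/
noncomputable def piCoeff (n : ℤ) (F : ℂ → ℂ) : ℂ :=
  ∫ x in (0 : ℝ)..Real.pi, F x * exp (-2 * n * I * x)

/-- The integral of a `π`-periodic entire function over a period does not depend on the
starting point. -/
lemma integral_period_add_eq {G : ℂ → ℂ} (hG : Differentiable ℂ G)
    (hp : ∀ z, G (z + Real.pi) = G z) (w : ℂ) :
    ∫ x in (0 : ℝ)..Real.pi, G (x + w) = ∫ x in (0 : ℝ)..Real.pi, G x := by
  have hrect := Complex.integral_boundary_rect_eq_zero_of_differentiableOn G 0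
    (Real.pi + w.im * I) hG.differentiableOn
  have hside : ∀ y : ℝ, G (Real.pi + y * I) = G (y * I) := fun y => by
    rw [add_comm, hp]
  simp [hside] at hrect
  rw [sub_eq_zero] at hrect
  rw [hrect]
  have hper : Function.Periodic (fun x : ℝ => G (x + w.im * I)) Real.pi := fun x => by
    simp only [ofReal_add]
    rw [add_right_comm, hp]
  have h := hper.intervalIntegral_add_eq w.re 0
  rw [zero_add] at h
  rw [← h, add_comm w.re, ← zero_add w.re, ← add_assoc,
    ← intervalIntegral.integral_comp_add_right, add_zero]
  refine intervalIntegral.integral_congr fun x _ => ?_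
  simp only [ofReal_add, add_assoc, re_add_im]

namespace IsOrderTwoTheta

variable {τ : ℂ} {F G : ℂ → ℂ}

lemma const_mul (c : ℂ) (hF : IsOrderTwoTheta τ F) : IsOrderTwoTheta τ (fun z => c * F z) where
  differentiable := hF.differentiable.const_mul c
  add_pi z := by rw [hF.add_pi]
  add_pi_mul z := by rw [hF.add_pi_mul]; ring

lemma add (hF : IsOrderTwoTheta τ F) (hG : IsOrderTwoTheta τ G) :
    IsOrderTwoTheta τ (fun z => F z + G z) where
  differentiable := hF.differentiable.add hG.differentiable
  add_pi z := by rw [hF.add_pi, hG.add_pi]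
  add_pi_mul z := by rw [hF.add_pi_mul, hG.add_pi_mul]; ring

lemma piCoeff_add (hF : IsOrderTwoTheta τ F) (hG : IsOrderTwoTheta τ G) (n : ℤ) :
    piCoeff n (fun z => F z + G z) = piCoeff n F + piCoeff n G := by
  have hF' := hF.differentiable.continuous
  have hG' := hG.differentiable.continuous
  simp only [piCoeff, add_mul]
  exact intervalIntegral.integral_add (Continuous.intervalIntegrable (by fun_prop) _ _)
    (Continuous.intervalIntegrable (by fun_prop) _ _)

lemma piCoeff_const_mul (c : ℂ) (n : ℤ) (F : ℂ → ℂ) :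
    piCoeff n (fun z => c * F z) = c * piCoeff n F := by
  simp only [piCoeff, mul_assoc, intervalIntegral.integral_const_mul]

lemma piCoeff_eq (hF : IsOrderTwoTheta τ F) (n : ℤ) :
    piCoeff n F = exp (-2 * Real.pi * I * τ * (n + 1)) * piCoeff (n + 2) F := by
  have hd := hF.differentiable
  have h := integral_period_add_eq (G := fun z => F z * exp (-2 * n * I * z)) (by fun_prop)
    (fun z => by
      rw [hF.add_pi, show -2 * n * I * (z + Real.pi) =
        -2 * n * I * z + (-n : ℤ) * (2 * Real.pi * I) by push_cast; ring, exp_add,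
        exp_int_mul_two_pi_mul_I, mul_one]) (Real.pi * τ)
  rw [piCoeff, ← h, piCoeff, ← intervalIntegral.integral_const_mul]
  refine intervalIntegral.integral_congr fun x _ => ?_
  simp only [hF.add_pi_mul]
  rw [mul_right_comm, ← exp_add, mul_left_comm, ← exp_add, mul_comm]
  congr 2
  push_cast
  ring

lemma piCoeff_eq_zero (hF : IsOrderTwoTheta τ F) (h0 : piCoeff 0 F = 0) (h1 : piCoeff 1 F = 0)
    (n : ℤ) : piCoeff n F = 0 := by
  have hiff : ∀ n, piCoeff n F = 0 ↔ piCoeff (n + 2) F = 0 := fun n => by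
    rw [hF.piCoeff_eq n]; simp
  have key : ∀ n : ℤ, piCoeff n F = 0 ∧ piCoeff (n + 1) F = 0 := by
    intro n
    induction n using Int.induction_on with
    | zero => simpa using ⟨h0, h1⟩
    | succ k ih => exact ⟨ih.2, by rw [add_assoc]; exact (hiff _).1 ih.1⟩
    | pred k ih =>
      refine ⟨(hiff _).2 ?_, by simpa using ih.1⟩
      convert ih.2 using 2
      ring
  exact (key n).1

lemma eq_zero (hF : IsOrderTwoTheta τ F) (h0 : piCoeff 0 F = 0) (h1 : piCoeff 1 F = 0) :
    F = 0 := by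
  have : Fact (0 < Real.pi) := ⟨Real.pi_pos⟩
  have hper : Function.Periodic (fun x : ℝ => F x) Real.pi := fun x => by
    simp only [ofReal_add, hF.add_pi]
  have hcont : Continuous (fun x : ℝ => F x) := hF.differentiable.continuous.comp continuous_ofReal
  let f : C(AddCircle Real.pi, ℂ) := ⟨hper.lift, hcont.quotient_lift _⟩
  have hcoe : ∀ x : ℝ, f x = F x := fun x => rfl
  have hcoeff : fourierCoeff f = 0 := by
    ext n
    have hint : ∫ x in (0 : ℝ)..0 + Real.pi, fourier (-n) (x : AddCircle Real.pi) • f x =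
        piCoeff n F := by
      rw [zero_add, piCoeff]
      refine intervalIntegral.integral_congr fun x _ => ?_
      simp only [hcoe, smul_eq_mul, fourier_coe_apply]
      rw [mul_comm]
      have hpi : (Real.pi : ℂ) ≠ 0 := ofReal_ne_zero.2 Real.pi_ne_zero
      congr 2
      push_cast
      field_simp
    rw [fourierCoeff_eq_intervalIntegral f n 0, hint, hF.piCoeff_eq_zero h0 h1, smul_zero,
      Pi.zero_apply]
  have hreal : ∀ x : ℝ, F x = 0 := fun x => by
    have h := has_pointwise_sum_fourier_series_of_summable (f := f)
      (by rw [hcoeff]; exact summable_zero) (x : AddCircle Real.pi)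
    rw [hcoeff] at h
    simp only [Pi.zero_apply, zero_smul] at h
    exact h.unique hasSum_zero
  have han : AnalyticOnNhd ℂ F Set.univ := fun z _ => hF.differentiable.analyticAt z
  refine han.eq_of_frequently_eq (z₀ := 0) (fun z _ => analyticAt_const) ?_
  have ht : Tendsto (fun x : ℝ => (x : ℂ)) (𝓝[≠] 0) (𝓝[≠] 0) := by
    refine tendsto_nhdsWithin_iff.2 ⟨?_, ?_⟩
    · exact (continuous_ofReal.tendsto' 0 0 ofReal_zero).mono_left nhdsWithin_le_nhds
    · filter_upwards [self_mem_nhdsWithin] with x hx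
      simpa using hx
  exact ht.frequently (Eventually.of_forall fun x => by simp [hreal]).frequently

/-- The theta functions of order two form a space of dimension at most two. -/
lemma exists_eq_add {g h f : ℂ → ℂ} (hg : IsOrderTwoTheta τ g) (hh : IsOrderTwoTheta τ h)
    (hf : IsOrderTwoTheta τ f)
    (hind : ∀ a b : ℂ, (∀ z, a * g z + b * h z = 0) → a = 0 ∧ b = 0) :
    ∃ A B : ℂ, ∀ z, f z = A * g z + B * h z := by
  set g0 := piCoeff 0 g
  set g1 := piCoeff 1 g
  set h0 := piCoeff 0 h
  set h1 := piCoeff 1 h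
  set f0 := piCoeff 0 f
  set f1 := piCoeff 1 f
  have hzero : ∀ a b c : ℂ, a * g0 + b * h0 + c * f0 = 0 → a * g1 + b * h1 + c * f1 = 0 →
      ∀ z, a * g z + b * h z + c * f z = 0 := fun a b c e0 e1 => by
    have hgh := (hg.const_mul a).add (hh.const_mul b)
    refine congrFun ((hgh.add (hf.const_mul c)).eq_zero ?_ ?_) <;>
    simpa only [hgh.piCoeff_add (hf.const_mul c), (hg.const_mul a).piCoeff_add (hh.const_mul b),
      piCoeff_const_mul]
  have hdet : g0 * h1 - g1 * h0 ≠ 0 := fun hdet => by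
    have e0 := hind h0 (-g0) fun z => by
      simpa using hzero h0 (-g0) 0 (by ring) (by linear_combination -hdet) z
    have e1 := hind h1 (-g1) fun z => by
      simpa using hzero h1 (-g1) 0 (by linear_combination hdet) (by ring) z
    have := hind 1 0 fun z => by
      have := hzero 1 0 0 (by linear_combination -e0.2) (by linear_combination -e1.2) z
      simpa using this
    exact one_ne_zero this.1
  refine ⟨(f0 * h1 - f1 * h0) / (g0 * h1 - g1 * h0), (g0 * f1 - g1 * f0) / (g0 * h1 - g1 * h0),
    fun z => ?_⟩
  have := hzero (f0 * h1 - f1 * h0) (g0 * f1 - g1 * f0) (-(g0 * h1 - g1 * h0)) (by ring) (by ring) z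
  rw [div_mul_eq_mul_div, div_mul_eq_mul_div, ← add_div, eq_div_iff hdet]
  linear_combination -this

end IsOrderTwoTheta

section Theta

variable {τ : ℂ}

lemma theta1_eq_jacobiTheta₂ (hτ : 0 < τ.im) (z : ℂ) :
    theta1 z τ = -I * exp (Real.pi * I * τ / 4) * exp (I * z) *
      jacobiTheta₂ (z / Real.pi + 1 / 2 + τ / 2) τ := by
  have hpi : (Real.pi : ℂ) ≠ 0 := ofReal_ne_zero.2 Real.pi_ne_zero
  have hsum := ((hasSum_jacobiTheta₂_term (z / Real.pi + 1 / 2 + τ / 2) hτ).mul_left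
    (-I * exp (Real.pi * I * τ / 4) * exp (I * z))).nat_add_neg_add_one
  rw [← hsum.tsum_eq, theta1, ← tsum_mul_left]
  refine tsum_congr fun n => ?_
  have hsign : ∀ k : ℤ, exp (Real.pi * I * k) = (-1) ^ k := fun k => by
    rw [mul_comm, exp_int_mul, exp_pi_mul_I]
  have hterm : ∀ k : ℤ, -I * exp (Real.pi * I * τ / 4) * exp (I * z) *
      jacobiTheta₂_term k (z / Real.pi + 1 / 2 + τ / 2) τ =
      -I * ((-1) ^ k * exp (Real.pi * I * τ * (2 * k + 1) ^ 2 / 4) *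
        exp ((2 * k + 1) * z * I)) := fun k => by
    rw [← hsign, jacobiTheta₂_term, mul_assoc, mul_assoc, ← exp_add, ← exp_add, ← exp_add,
      ← exp_add]
    congr 2
    field_simp
    ring
  rw [hterm, hterm, Complex.sin]
  have h1 : ((-1 : ℂ)) ^ (-((n : ℤ) + 1)) = -(-1) ^ n := by
    rw [zpow_neg, zpow_add_one₀ (by norm_num), zpow_natCast]
    rcases neg_one_pow_eq_or ℂ n with h | h <;> simp [h]
  rw [h1, zpow_natCast]
  push_cast
  rw [show (2 * -((n : ℂ) + 1) + 1) = -(2 * n + 1) by ring, neg_sq,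
    show -((2 * (n : ℂ) + 1) * z) * I = -(2 * n + 1) * z * I by ring]
  ring

lemma differentiable_theta1 (hτ : 0 < τ.im) : Differentiable ℂ (fun z => theta1 z τ) := by
  simp only [theta1_eq_jacobiTheta₂ hτ]
  have h : Differentiable ℂ (fun z => jacobiTheta₂ z τ) := fun z =>
    differentiableAt_jacobiTheta₂_fst z hτ
  have h' : Differentiable ℂ (fun z : ℂ => jacobiTheta₂ (z / Real.pi + 1 / 2 + τ / 2) τ) :=
    h.comp (by fun_prop : Differentiable ℂ fun z : ℂ => z / Real.pi + 1 / 2 + τ / 2)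
  fun_prop

lemma theta1_neg (z : ℂ) : theta1 (-z) τ = -theta1 z τ := by
  simp only [theta1, mul_neg, sin_neg, tsum_neg]

lemma theta1_zero : theta1 0 τ = 0 := by simp [theta1]

lemma theta1_add_pi (z : ℂ) : theta1 (z + Real.pi) τ = -theta1 z τ := by
  rw [theta1, theta1, ← mul_neg, ← tsum_neg]
  congr 2 with n
  rw [show (2 * (n : ℂ) + 1) * (z + Real.pi) = (2 * n + 1) * z + Real.pi + n * (2 * Real.pi) by
    ring, sin_add_nat_mul_two_pi, sin_add_pi, mul_neg]

lemma theta1_add_pi_mul (hτ : 0 < τ.im) (z : ℂ) :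
    theta1 (z + Real.pi * τ) τ = -exp (-Real.pi * I * τ - 2 * I * z) * theta1 z τ := by
  have hpi : (Real.pi : ℂ) ≠ 0 := ofReal_ne_zero.2 Real.pi_ne_zero
  rw [theta1_eq_jacobiTheta₂ hτ, theta1_eq_jacobiTheta₂ hτ,
    show (z + Real.pi * τ) / Real.pi + 1 / 2 + τ / 2 = (z / Real.pi + 1 / 2 + τ / 2) + τ by
      field_simp; ring, jacobiTheta₂_add_left',
    show -Real.pi * I * (τ + 2 * (z / Real.pi + 1 / 2 + τ / 2)) =
      (-Real.pi * I * τ - 2 * I * z) + -(I * (Real.pi * τ)) - Real.pi * I by field_simp; ring,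
    exp_sub, exp_pi_mul_I, exp_add, exp_neg, mul_add, exp_add (I * z)]
  field_simp

lemma theta1_add_int_mul (hτ : 0 < τ.im) {z : ℂ} (hz : theta1 z τ = 0) (m n : ℤ) :
    theta1 (z + (m * Real.pi + n * (Real.pi * τ))) τ = 0 := by
  have h1 : ∀ w, theta1 (w + Real.pi) τ = 0 ↔ theta1 w τ = 0 := fun w => by
    rw [theta1_add_pi, neg_eq_zero]
  have h2 : ∀ w, theta1 (w + Real.pi * τ) τ = 0 ↔ theta1 w τ = 0 := fun w => by
    rw [theta1_add_pi_mul hτ]; simp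
  have h3 : ∀ m : ℤ, theta1 (z + m * Real.pi) τ = 0 := fun m => by
    induction m using Int.induction_on with
    | zero => simpa
    | succ k ih => rw [← h1] at ih; convert ih using 2; push_cast; ring
    | pred k ih => rw [← h1]; convert ih using 2; push_cast; ring
  rw [← add_assoc]
  induction n using Int.induction_on with
  | zero => simpa using h3 m
  | succ k ih => rw [← h2] at ih; convert ih using 2; push_cast; ring
  | pred k ih => rw [← h2]; convert ih using 2; push_cast; ring

lemma integral_jacobiTheta₂ (hτ : 0 < τ.im) :
    ∫ x in (0 : ℝ)..1, jacobiTheta₂ x τ = 1 := by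
  have hsum := intervalIntegral.hasSum_integral_of_dominated_convergence
    (μ := MeasureTheory.volume) (a := 0) (b := 1)
    (F := fun (n : ℤ) (x : ℝ) => jacobiTheta₂_term n x τ) (f := fun x : ℝ => jacobiTheta₂ x τ)
    (fun n _ => ‖jacobiTheta₂_term n 0 τ‖)
    (fun n => Continuous.aestronglyMeasurable (by unfold jacobiTheta₂_term; fun_prop))
    (fun n => Eventually.of_forall fun x _ => by simp [norm_jacobiTheta₂_term])
    (Eventually.of_forall fun x _ => ((summable_jacobiTheta₂_term_iff 0 τ).2 hτ).norm)
    (by simp)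
    (Eventually.of_forall fun x _ => hasSum_jacobiTheta₂_term _ hτ)
  rw [← hsum.tsum_eq, tsum_eq_single 0]
  · simp [jacobiTheta₂_term]
  · intro n hn
    have hc : 2 * Real.pi * I * n ≠ 0 := by
      simpa [Real.pi_ne_zero] using hn
    simp only [jacobiTheta₂_term, exp_add, intervalIntegral.integral_mul_const]
    rw [integral_exp_mul_complex hc]
    rw [show 2 * Real.pi * I * n * (1 : ℝ) = n * (2 * Real.pi * I) by push_cast; ring,
      exp_int_mul_two_pi_mul_I]
    simp

lemma exists_theta1_ne_zero (hτ : 0 < τ.im) : ∃ z, theta1 z τ ≠ 0 := by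
  have hpi : (Real.pi : ℂ) ≠ 0 := ofReal_ne_zero.2 Real.pi_ne_zero
  by_contra! h
  have hz : ∀ w, jacobiTheta₂ w τ = 0 := fun w => by
    have := h (Real.pi * (w - 1 / 2 - τ / 2))
    rw [theta1_eq_jacobiTheta₂ hτ, mul_div_cancel_left₀ _ hpi,
      show w - 1 / 2 - τ / 2 + 1 / 2 + τ / 2 = w by ring] at this
    simpa using this
  simpa [hz] using integral_jacobiTheta₂ hτ

lemma eventually_theta1_ne_zero (hτ : 0 < τ.im) (a : ℂ) : ∀ᶠ z in 𝓝[≠] a, theta1 z τ ≠ 0 := by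
  by_contra hcon
  have han : AnalyticOnNhd ℂ (fun z => theta1 z τ) Set.univ := fun z _ =>
    (differentiable_theta1 hτ).analyticAt z
  obtain ⟨z, hz⟩ := exists_theta1_ne_zero hτ
  refine hz (congrFun (han.eq_of_frequently_eq (z₀ := a) (g := 0)
    (fun z _ => analyticAt_const) ?_) z)
  simpa only [Filter.Frequently, Pi.zero_apply] using! hcon

lemma isOrderTwoTheta_theta1_mul (hτ : 0 < τ.im) (y : ℂ) :
    IsOrderTwoTheta τ (fun z => theta1 (z + y) τ * theta1 (z - y) τ) where
  differentiable := ((differentiable_theta1 hτ).comp (differentiable_id.add_const y)).mul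
    ((differentiable_theta1 hτ).comp (differentiable_id.sub_const y))
  add_pi z := by
    rw [add_right_comm, theta1_add_pi, add_sub_right_comm, theta1_add_pi, neg_mul_neg]
  add_pi_mul z := by
    rw [add_right_comm, theta1_add_pi_mul hτ, add_sub_right_comm, theta1_add_pi_mul hτ,
      mul_mul_mul_comm, neg_mul_neg, ← exp_add]
    congr 2
    ring

end Theta

section Weierstrass

variable {τ : ℂ}

/-- The period pair `(π, πτ)`. -/
noncomputable def piPeriodPair (τ : ℂ) (hτ : 0 < τ.im) : PeriodPair where
  ω₁ := Real.pi
  ω₂ := Real.pi * τ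
  indep := by
    refine LinearIndependent.pair_iff.2 fun s t h => ?_
    have him := congrArg Complex.im h
    have hre := congrArg Complex.re h
    have ht : t = 0 := by simpa [Real.pi_ne_zero, hτ.ne'] using him
    subst ht
    exact ⟨by simpa [Real.pi_ne_zero] using hre, rfl⟩

lemma mem_lattice_piPeriodPair (hτ : 0 < τ.im) {z : ℂ} :
    z ∈ (piPeriodPair τ hτ).lattice ↔ ∃ m n : ℤ, z = m * Real.pi + n * Real.pi * τ := by
  simp only [PeriodPair.mem_lattice, piPeriodPair, mul_assoc, eq_comm]

lemma wp_eq_weierstrassP (hτ : 0 < τ.im) (z : ℂ) :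
    wp τ z = (piPeriodPair τ hτ).weierstrassP z := by
  set L := piPeriodPair τ hτ
  have hpt : ∀ p, (L.latticeEquivProd.symm p : ℂ) = latticePt τ p := fun p => by
    rw [PeriodPair.latticeEquiv_symm_apply, latticePt, mul_assoc]
    rfl
  have hsum := (L.latticeEquivProd.symm.toEquiv.hasSum_iff).2 (L.hasSum_weierstrassP z)
  have hfun : ((fun l : L.lattice => 1 / (z - l) ^ 2 - 1 / (l : ℂ) ^ 2) ∘
      L.latticeEquivProd.symm.toEquiv) =
      fun p => 1 / (z - latticePt τ p) ^ 2 - 1 / latticePt τ p ^ 2 := by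
    ext p
    simp [← hpt]
  rw [hfun] at hsum
  have h := hsum.summable.tsum_subtype_add_tsum_subtype_compl {0}
  rw [hsum.tsum_eq,
    tsum_singleton 0 (fun p => 1 / (z - latticePt τ p) ^ 2 - 1 / latticePt τ p ^ 2)] at h
  rw [wp, ← h]
  congr 1
  simp [latticePt]

lemma theta1_eq_zero_of_mem_lattice (hτ : 0 < τ.im) {l : ℂ}
    (hl : l ∈ (piPeriodPair τ hτ).lattice) : theta1 l τ = 0 := by
  obtain ⟨m, n, rfl⟩ := (mem_lattice_piPeriodPair hτ).1 hl
  simpa [mul_assoc] using theta1_add_int_mul hτ theta1_zero m n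

lemma eventually_notMem_lattice (L : PeriodPair) (a : ℂ) : ∀ᶠ z in 𝓝[≠] a, z ∉ L.lattice := by
  filter_upwards [nhdsWithin_le_nhds (L.compl_lattice_sdiff_singleton_mem_nhds a),
    self_mem_nhdsWithin] with z hz hne hmem
  exact hz ⟨hmem, hne⟩

open Classical in
/-- The entire function extending `℘ θ₁²`. -/
noncomputable def wpThetaSq (τ : ℂ) (hτ : 0 < τ.im) (z : ℂ) : ℂ :=
  if z ∈ (piPeriodPair τ hτ).lattice then theta1' z τ ^ 2
  else (piPeriodPair τ hτ).weierstrassP z * theta1 z τ ^ 2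

lemma wpThetaSq_of_notMem (hτ : 0 < τ.im) {z : ℂ} (hz : z ∉ (piPeriodPair τ hτ).lattice) :
    wpThetaSq τ hτ z = (piPeriodPair τ hτ).weierstrassP z * theta1 z τ ^ 2 := if_neg hz

lemma wpThetaSq_zero (hτ : 0 < τ.im) : wpThetaSq τ hτ 0 = theta1' 0 τ ^ 2 := if_pos (zero_mem _)

lemma differentiable_wpThetaSq (hτ : 0 < τ.im) : Differentiable ℂ (wpThetaSq τ hτ) := by
  intro a
  set L := piPeriodPair τ hτ
  have hθ := differentiable_theta1 hτ
  have hmem := L.compl_lattice_sdiff_singleton_mem_nhds a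
  by_cases ha : a ∈ L.lattice
  · have hloc : wpThetaSq τ hτ =ᶠ[𝓝 a] fun z =>
        (L.weierstrassPExcept a z - 1 / a ^ 2) * theta1 z τ ^ 2 +
          dslope (fun w => theta1 w τ) a z ^ 2 := by
      filter_upwards [hmem] with z hz
      by_cases hza : z = a
      · subst hza
        rw [wpThetaSq, if_pos ha, dslope_same, theta1_eq_zero_of_mem_lattice hτ ha, theta1']
        ring
      · have hz' : z ∉ L.lattice := fun h => hz ⟨h, hza⟩
        rw [wpThetaSq_of_notMem hτ hz', dslope_of_ne _ hza, slope_def_field,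
          theta1_eq_zero_of_mem_lattice hτ ha, L.weierstrassPExcept_def ⟨a, ha⟩]
        have hne : z - a ≠ 0 := sub_ne_zero.2 hza
        field_simp
        ring
    refine DifferentiableAt.congr_of_eventuallyEq ?_ hloc
    have h1 : DifferentiableAt ℂ (L.weierstrassPExcept a) a :=
      (L.differentiableOn_weierstrassPExcept a).differentiableAt hmem
    have h2 : DifferentiableAt ℂ (dslope (fun w => theta1 w τ) a) a :=
      ((Complex.differentiableOn_dslope univ_mem).2 hθ.differentiableOn).differentiableAt univ_mem
    exact ((h1.sub_const _).mul ((hθ a).pow 2)).add (h2.pow 2)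
  · have hmem' : (L.lattice : Set ℂ)ᶜ ∈ 𝓝 a := L.isClosed_lattice.isOpen_compl.mem_nhds ha
    have hloc : wpThetaSq τ hτ =ᶠ[𝓝 a] fun z => L.weierstrassP z * theta1 z τ ^ 2 := by
      filter_upwards [hmem'] with z hz using wpThetaSq_of_notMem hτ hz
    refine DifferentiableAt.congr_of_eventuallyEq ?_ hloc
    exact (L.differentiableOn_weierstrassP.differentiableAt hmem').mul ((hθ a).pow 2)

lemma isOrderTwoTheta_theta1_sq (hτ : 0 < τ.im) : IsOrderTwoTheta τ (fun z => theta1 z τ ^ 2) := by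
  simpa [sq] using isOrderTwoTheta_theta1_mul hτ 0

lemma eq_of_eqOn_compl_lattice (L : PeriodPair) {f g : ℂ → ℂ} (hf : Continuous f)
    (hg : Continuous g) (h : ∀ z ∉ L.lattice, f z = g z) (z : ℂ) : f z = g z :=
  tendsto_nhds_unique_of_eventuallyEq (hf.continuousAt.continuousWithinAt (s := {z}ᶜ))
    hg.continuousAt.continuousWithinAt
    ((eventually_notMem_lattice L z).mono h)

lemma isOrderTwoTheta_wpThetaSq (hτ : 0 < τ.im) : IsOrderTwoTheta τ (wpThetaSq τ hτ) where
  differentiable := differentiable_wpThetaSq hτ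
  add_pi := by
    have hc := (differentiable_wpThetaSq hτ).continuous
    refine eq_of_eqOn_compl_lattice (piPeriodPair τ hτ) (by fun_prop) hc fun z hz => ?_
    have hω := (piPeriodPair τ hτ).ω₁_mem_lattice
    have h := (piPeriodPair τ hτ).weierstrassP_add_coe z ⟨_, hω⟩
    have hz' : z + Real.pi ∉ (piPeriodPair τ hτ).lattice := fun h' =>
      hz ((Submodule.add_mem_iff_left _ hω).1 h')
    rw [wpThetaSq_of_notMem hτ hz', wpThetaSq_of_notMem hτ hz,
      (isOrderTwoTheta_theta1_sq hτ).add_pi]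
    exact congrArg (· * _) h
  add_pi_mul := by
    have hc := (differentiable_wpThetaSq hτ).continuous
    refine eq_of_eqOn_compl_lattice (piPeriodPair τ hτ) (by fun_prop) (by fun_prop) fun z hz => ?_
    have hω := (piPeriodPair τ hτ).ω₂_mem_lattice
    have h := (piPeriodPair τ hτ).weierstrassP_add_coe z ⟨_, hω⟩
    have hz' : z + Real.pi * τ ∉ (piPeriodPair τ hτ).lattice := fun h' =>
      hz ((Submodule.add_mem_iff_left _ hω).1 h')
    rw [wpThetaSq_of_notMem hτ hz', wpThetaSq_of_notMem hτ hz,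
      (isOrderTwoTheta_theta1_sq hτ).add_pi_mul, mul_left_comm]
    exact congrArg (fun w => _ * (w * _)) h

lemma wpThetaSq_linearIndependent (hτ : 0 < τ.im) (a b : ℂ)
    (h : ∀ z, a * theta1 z τ ^ 2 + b * wpThetaSq τ hτ z = 0) : a = 0 ∧ b = 0 := by
  set L := piPeriodPair τ hτ
  have hev : ∀ᶠ z in 𝓝[≠] (0 : ℂ), a + b * L.weierstrassP z = 0 := by
    filter_upwards [eventually_notMem_lattice L 0, eventually_theta1_ne_zero hτ 0] with z hz hne
    have := h z
    rw [wpThetaSq_of_notMem hτ hz] at this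
    refine (mul_eq_zero.1 ?_).resolve_right (pow_ne_zero 2 hne)
    linear_combination this
  have hb : b = 0 := by
    by_contra hb
    have hconst : L.weierstrassP =ᶠ[𝓝[≠] (0 : ℂ)] fun _ => -a / b := by
      filter_upwards [hev] with z hz
      rw [eq_div_iff hb]
      linear_combination hz
    have hord := meromorphicOrderAt_congr hconst
    rw [L.order_weierstrassP 0 (zero_mem _)] at hord
    have hnonneg : 0 ≤ meromorphicOrderAt (fun _ : ℂ => -a / b) 0 :=
      (analyticAt_const).meromorphicOrderAt_nonneg
    rw [← hord] at hnonneg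
    exact absurd hnonneg (by decide)
  subst hb
  obtain ⟨z, hz⟩ := hev.exists
  exact ⟨by simpa using hz, rfl⟩

lemma theta1_mul_theta1_eq (hτ : 0 < τ.im) {x y : ℂ} (hx : x ∉ (piPeriodPair τ hτ).lattice)
    (hθ : theta1 y τ ≠ 0) :
    theta1' 0 τ ^ 2 * (theta1 (x + y) τ * theta1 (x - y) τ) =
      -(wp τ x - wp τ y) * (theta1 x τ ^ 2 * theta1 y τ ^ 2) := by
  have hy : y ∉ (piPeriodPair τ hτ).lattice := fun h => hθ (theta1_eq_zero_of_mem_lattice hτ h)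
  obtain ⟨A, B, hAB⟩ := (isOrderTwoTheta_theta1_sq hτ).exists_eq_add
    (isOrderTwoTheta_wpThetaSq hτ) (isOrderTwoTheta_theta1_mul hτ y)
    (wpThetaSq_linearIndependent hτ)
  have h0 := hAB 0
  have h1 := hAB y
  have h2 := hAB x
  rw [wpThetaSq_zero, theta1_zero, zero_add, zero_sub, theta1_neg] at h0
  rw [wpThetaSq_of_notMem hτ hy, ← wp_eq_weierstrassP, sub_self, theta1_zero, mul_zero] at h1
  rw [wpThetaSq_of_notMem hτ hx, ← wp_eq_weierstrassP] at h2
  have hA : A + B * wp τ y = 0 := by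
    refine (mul_eq_zero.1 ?_).resolve_right (pow_ne_zero 2 hθ)
    linear_combination -h1
  rw [h2]
  linear_combination theta1' 0 τ ^ 2 * theta1 x τ ^ 2 * hA -
    (wp τ x - wp τ y) * theta1 x τ ^ 2 * h0

lemma theta1'_zero_ne_zero (hτ : 0 < τ.im) : theta1' 0 τ ≠ 0 := by
  obtain ⟨y, hy⟩ := exists_theta1_ne_zero hτ
  obtain ⟨A, B, hAB⟩ := (isOrderTwoTheta_theta1_sq hτ).exists_eq_add
    (isOrderTwoTheta_wpThetaSq hτ) (isOrderTwoTheta_theta1_mul hτ y)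
    (wpThetaSq_linearIndependent hτ)
  intro hD
  have h0 := hAB 0
  rw [wpThetaSq_zero, theta1_zero, zero_add, zero_sub, theta1_neg, hD] at h0
  exact hy (by simpa using h0)

lemma theta1_ne_zero_of_notMem_lattice (hτ : 0 < τ.im) {x : ℂ}
    (hx : x ∉ (piPeriodPair τ hτ).lattice) : theta1 x τ ≠ 0 := by
  intro hx0
  have hadd : ∀ᶠ z in 𝓝[≠] x, theta1 (x + z) τ ≠ 0 := by
    have ht : Tendsto (fun z => x + z) (𝓝[≠] x) (𝓝[≠] (x + x)) :=
      tendsto_nhdsWithin_iff.2 ⟨((continuous_const_add x).tendsto x).mono_left nhdsWithin_le_nhds,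
        by filter_upwards [self_mem_nhdsWithin] with z hz using fun h => hz (add_left_cancel h)⟩
    exact ht.eventually (eventually_theta1_ne_zero hτ _)
  have hsub : ∀ᶠ z in 𝓝[≠] x, theta1 (x - z) τ ≠ 0 := by
    have ht : Tendsto (fun z => x - z) (𝓝[≠] x) (𝓝[≠] (x - x)) :=
      tendsto_nhdsWithin_iff.2 ⟨((continuous_sub_left x).tendsto x).mono_left nhdsWithin_le_nhds,
        by filter_upwards [self_mem_nhdsWithin] with z hz using fun h => hz (sub_right_injective h)⟩
    exact ht.eventually (eventually_theta1_ne_zero hτ _)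
  obtain ⟨z, ha, hs, hz⟩ := (hadd.and (hsub.and (eventually_theta1_ne_zero hτ x))).exists
  have h := theta1_mul_theta1_eq hτ hx hz
  rw [hx0] at h
  simp [ha, hs, theta1'_zero_ne_zero hτ] at h

end Weierstrass

theorem weierstrass_addition (τ : ℂ) (hτ : 0 < τ.im) (x y : ℂ)
    (hx : ∀ m l : ℤ, x ≠ m * Real.pi + l * Real.pi * τ)
    (hy : ∀ m l : ℤ, y ≠ m * Real.pi + l * Real.pi * τ) :
    wp τ x - wp τ y =
      -theta1' 0 τ ^ 2 * theta1 (x + y) τ * theta1 (x - y) τ /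
        (theta1 x τ ^ 2 * theta1 y τ ^ 2) := by
  have hx' : x ∉ (piPeriodPair τ hτ).lattice := fun h =>
    let ⟨m, l, e⟩ := (mem_lattice_piPeriodPair hτ).1 h
    hx m l e
  have hy' : y ∉ (piPeriodPair τ hτ).lattice := fun h =>
    let ⟨m, l, e⟩ := (mem_lattice_piPeriodPair hτ).1 h
    hy m l e
  have hθx := theta1_ne_zero_of_notMem_lattice hτ hx'
  have hθy := theta1_ne_zero_of_notMem_lattice hτ hy'
  rw [eq_div_iff (mul_ne_zero (pow_ne_zero 2 hθx) (pow_ne_zero 2 hθy))]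
  linear_combination theta1_mul_theta1_eq hτ hx' hθy
end

section
/- Let τ have positive imaginary part and q = exp(2πiτ). For all complex z not in the zero lattice of θ₁(·|τ), the logarithmic derivative of the first Jacobi theta function satisfies θ₁'(z|τ)/θ₁(z|τ) = cot z + 4∑_{n=1}^{∞} (qⁿ/(1-qⁿ))·sin(2nz), provided the series converges (which holds when |Im z| < π·Im τ). -/
open Complex

open Filter Topology

/-- The reciprocal `1 / ((1 - q) ⋯ (1 - q ^ k))` of the `q`-Pochhammer symbol, extended by zero to
negative `k`. -/
noncomputable def invQPochhammer (q : ℂ) (k : ℤ) : ℂ :=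
  if k < 0 then 0 else (∏ i ∈ Finset.range k.toNat, (1 - q ^ (i + 1)))⁻¹

lemma one_sub_ne_zero_of_norm_lt_one {x : ℂ} (hx : ‖x‖ < 1) : 1 - x ≠ 0 := by
  intro h
  rw [← sub_eq_zero.mp h] at hx
  simp at hx

lemma one_sub_pow_succ_ne_zero {q : ℂ} (hq : ‖q‖ < 1) (n : ℕ) : 1 - q ^ (n + 1) ≠ 0 :=
  one_sub_ne_zero_of_norm_lt_one <| by
    rw [norm_pow]
    exact pow_lt_one₀ (norm_nonneg q) hq n.succ_ne_zero

lemma invQPochhammer_of_neg (q : ℂ) {k : ℤ} (hk : k < 0) : invQPochhammer q k = 0 := by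
  simp [invQPochhammer, hk]

lemma invQPochhammer_natCast (q : ℂ) (k : ℕ) :
    invQPochhammer q k = (∏ i ∈ Finset.range k, (1 - q ^ (i + 1)))⁻¹ := by
  simp [invQPochhammer]

lemma invQPochhammer_sub_one {q : ℂ} (hq : ‖q‖ < 1) (k : ℤ) :
    invQPochhammer q (k - 1) = (1 - q ^ k) * invQPochhammer q k := by
  rcases lt_trichotomy k 0 with hk | rfl | hk
  · rw [invQPochhammer_of_neg q hk, invQPochhammer_of_neg q (by lia), mul_zero]
  · simp [invQPochhammer_of_neg]
  · obtain ⟨m, rfl⟩ : ∃ m : ℕ, k = ((m + 1 : ℕ) : ℤ) := ⟨(k - 1).toNat, by lia⟩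
    have hm : (((m + 1 : ℕ) : ℤ) - 1) = (m : ℤ) := by push_cast; ring
    rw [hm, invQPochhammer_natCast, invQPochhammer_natCast, Finset.prod_range_succ, mul_inv,
      zpow_natCast, mul_comm (_⁻¹) (_⁻¹), mul_inv_cancel_left₀ (one_sub_pow_succ_ne_zero hq m)]

lemma summable_norm_neg_pow_succ_mul {q : ℂ} (hq : ‖q‖ < 1) (u : ℂ) :
    Summable fun n : ℕ ↦ ‖-(q ^ (n + 1) * u)‖ := by
  simp only [norm_neg, norm_mul, norm_pow]
  exact ((summable_nat_add_iff 1).mpr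
    (summable_geometric_of_lt_one (norm_nonneg _) hq)).mul_right _

lemma multipliable_one_sub_pow_succ_mul {q : ℂ} (hq : ‖q‖ < 1) (u : ℂ) :
    Multipliable fun n : ℕ ↦ 1 - q ^ (n + 1) * u := by
  simpa only [sub_eq_add_neg] using
    multipliable_one_add_of_summable (summable_norm_neg_pow_succ_mul hq u)

lemma norm_pow_succ_mul_lt_one {q u : ℂ} (hq : ‖q‖ < 1) (hu : ‖q * u‖ < 1) (n : ℕ) :
    ‖q ^ (n + 1) * u‖ < 1 := by
  rw [pow_succ, mul_assoc, norm_mul, norm_pow]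
  exact (mul_le_of_le_one_left (norm_nonneg _) (pow_le_one₀ (norm_nonneg q) hq.le)).trans_lt hu

lemma tprod_one_sub_pow_succ_mul_ne_zero {q u : ℂ} (hq : ‖q‖ < 1) (hu : ‖q * u‖ < 1) :
    ∏' n : ℕ, (1 - q ^ (n + 1) * u) ≠ 0 := by
  simpa only [sub_eq_add_neg] using tprod_one_add_ne_zero_of_summable
    (f := fun n : ℕ ↦ -(q ^ (n + 1) * u))
    (fun n ↦ by
      simpa only [sub_eq_add_neg] using
        one_sub_ne_zero_of_norm_lt_one (norm_pow_succ_mul_lt_one hq hu n))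
    (summable_norm_neg_pow_succ_mul hq u)

lemma exists_tendsto_invQPochhammer {q : ℂ} (hq : ‖q‖ < 1) :
    ∃ a : ℂ, Tendsto (fun k : ℤ ↦ invQPochhammer q k) atTop (𝓝 a) := by
  have hprod := (multipliable_one_sub_pow_succ_mul hq 1).hasProd.tendsto_prod_nat
  have hne := tprod_one_sub_pow_succ_mul_ne_zero (u := 1) hq (by simpa using hq)
  simp only [mul_one] at hprod hne
  refine ⟨_, ((hprod.inv₀ hne).comp (tendsto_atTop_atTop.2 fun b ↦ ⟨b, fun a ha ↦ ?_⟩ :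
    Tendsto Int.toNat atTop atTop)).congr' ?_⟩
  · lia
  · filter_upwards [eventually_ge_atTop (0 : ℤ)] with k hk
    simp [invQPochhammer, not_lt.2 hk]

lemma exists_norm_invQPochhammer_le {q : ℂ} (hq : ‖q‖ < 1) :
    ∃ C : ℝ, ∀ k : ℤ, ‖invQPochhammer q k‖ ≤ C := by
  obtain ⟨a, ha⟩ := exists_tendsto_invQPochhammer hq
  obtain ⟨C, hC⟩ := (ha.comp tendsto_natCast_atTop_atTop).norm.bddAbove_range
  refine ⟨max C 0, fun k ↦ ?_⟩
  rcases lt_or_ge k 0 with hk | hk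
  · simp [invQPochhammer_of_neg q hk]
  · lift k to ℕ using hk
    exact (hC ⟨k, rfl⟩).trans (le_max_left _ _)

/-- The finite form of the sum in Jacobi's triple product identity given by the `q`-binomial theorem. -/
noncomputable def tripleProductSum (q : ℂ) (t : ℤ → ℂ) (N : ℕ) : ℂ :=
  ∑' n : ℤ, invQPochhammer q (N - n) * invQPochhammer q (N + 1 + n) * t n

lemma summable_tripleProductSum (q : ℂ) (t : ℤ → ℂ) (N : ℕ) :
    Summable fun n : ℤ ↦ invQPochhammer q (N - n) * invQPochhammer q (N + 1 + n) * t n := by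
  refine summable_of_ne_finset_zero (s := Finset.Icc (-(N : ℤ) - 1) N) fun n hn ↦ ?_
  rw [Finset.mem_Icc, not_and_or] at hn
  rcases hn with hn | hn
  · rw [invQPochhammer_of_neg q (k := N + 1 + n) (by lia)]; simp
  · rw [invQPochhammer_of_neg q (k := N - n) (by lia)]; simp

lemma tripleProductSum_zero {q y : ℂ} {t : ℤ → ℂ} (hy : y ≠ 0)
    (ht : ∀ n, t (n + 1) = -(q ^ (n + 1) * y * t n)) :
    tripleProductSum q t 0 = (1 - y⁻¹) * t 0 / (1 - q) := by
  have h := ht (-1)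
  norm_num at h
  have h' : t (-1) = - (y⁻¹ * t 0) := by rw [h]; field_simp
  rw [tripleProductSum, tsum_eq_sum (s := {-1, 0})]
  · have h1 : invQPochhammer q 1 = (1 - q)⁻¹ := by simpa using invQPochhammer_natCast q 1
    have h0 : invQPochhammer q 0 = 1 := by simpa using invQPochhammer_natCast q 0
    simp [h1, h0, h']
    ring
  · intro n hn
    simp only [Finset.mem_insert, Finset.mem_singleton, not_or] at hn
    rcases lt_or_ge n 0 with h | h
    · rw [invQPochhammer_of_neg q (k := (0 : ℕ) + 1 + n) (by lia)]; simp
    · rw [invQPochhammer_of_neg q (k := (0 : ℕ) - n) (by lia)]; simp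

lemma tripleProductSum_term_succ {q y : ℂ} {t : ℤ → ℂ} (hq : ‖q‖ < 1) (hq0 : q ≠ 0) (hy : y ≠ 0)
    (ht : ∀ n, t (n + 1) = -(q ^ (n + 1) * y * t n)) (N : ℕ) (n : ℤ) :
    (1 - q ^ (2 * N + 1 + 1)) * (1 - q ^ (2 * N + 2 + 1)) *
      (invQPochhammer q ((N + 1 : ℕ) - n) * invQPochhammer q ((N + 1 : ℕ) + 1 + n) * t n) =
    (1 + q ^ (2 * N + 2)) * (invQPochhammer q (N - n) * invQPochhammer q (N + 1 + n) * t n) -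
      q ^ (N + 1) * y *
        (invQPochhammer q (N - (n - 1)) * invQPochhammer q (N + 1 + (n - 1)) * t (n - 1)) -
      q ^ (N + 1) * y⁻¹ *
        (invQPochhammer q (N - (n + 1)) * invQPochhammer q (N + 1 + (n + 1)) * t (n + 1)) := by
  have e1 : ((N : ℤ) - n) = (N + 1 - n) - 1 := by ring
  have e2 : ((N : ℤ) + 1 + n) = (N + 2 + n) - 1 := by ring
  have e3 : ((N : ℤ) - (n - 1)) = N + 1 - n := by ring
  have e4 : ((N : ℤ) + 1 + (n - 1)) = (N + 2 + n) - 1 - 1 := by ring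
  have e5 : ((N : ℤ) - (n + 1)) = (N + 1 - n) - 1 - 1 := by ring
  have e6 : ((N : ℤ) + 1 + (n + 1)) = N + 2 + n := by ring
  have e7 : (((N + 1 : ℕ) : ℤ) - n) = N + 1 - n := by push_cast; ring
  have e8 : (((N + 1 : ℕ) : ℤ) + 1 + n) = N + 2 + n := by push_cast; ring
  have hn : t n = -(q ^ n * y * t (n - 1)) := by
    have := ht (n - 1)
    rwa [sub_add_cancel] at this
  simp only [e3, e4, e5, e6, e7, e8]
  rw [e1, e2]
  simp only [invQPochhammer_sub_one hq]
  have hb : t (n - 1) = - (t n * (q ^ n)⁻¹ * y⁻¹) := by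
    rw [hn]; field_simp
  rw [ht n, hb]
  simp only [zpow_sub₀ hq0, zpow_add₀ hq0, zpow_natCast, zpow_ofNat, pow_add,
    pow_mul', pow_one]
  have hZ : q ^ n ≠ 0 := zpow_ne_zero n hq0
  generalize q ^ n = Z at hZ ⊢
  generalize q ^ N = W
  generalize invQPochhammer q (N + 1 - n) = R
  generalize invQPochhammer q (N + 2 + n) = S
  generalize t n = T
  field_simp
  ring

lemma tsum_mul_add_mul_shift {f : ℤ → ℂ} (hf : Summable f) (a b c : ℂ) :
    ∑' n, (a * f n - b * f (n - 1) - c * f (n + 1)) = (a - b - c) * ∑' n, f n := by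
  have hL : HasSum (fun n ↦ f (n - 1)) (∑' n, f n) :=
    (Equiv.subRight (1 : ℤ)).hasSum_iff.2 hf.hasSum
  have hR : HasSum (fun n ↦ f (n + 1)) (∑' n, f n) :=
    (Equiv.addRight (1 : ℤ)).hasSum_iff.2 hf.hasSum
  rw [(((hf.hasSum.mul_left a).sub (hL.mul_left b)).sub (hR.mul_left c)).tsum_eq]
  ring

lemma tripleProductSum_succ {q y : ℂ} {t : ℤ → ℂ} (hq : ‖q‖ < 1) (hq0 : q ≠ 0) (hy : y ≠ 0)
    (ht : ∀ n, t (n + 1) = -(q ^ (n + 1) * y * t n)) (N : ℕ) :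
    (1 - q ^ (2 * N + 1 + 1)) * (1 - q ^ (2 * N + 2 + 1)) * tripleProductSum q t (N + 1) =
      (1 - q ^ (N + 1) * y) * (1 - q ^ (N + 1) * y⁻¹) * tripleProductSum q t N := by
  have hs := summable_tripleProductSum q t N
  rw [tripleProductSum, ← tsum_mul_left,
    tsum_congr (tripleProductSum_term_succ hq hq0 hy ht N), tripleProductSum]
  rw [tsum_mul_add_mul_shift hs]
  congr 1
  field_simp
  ring

lemma tripleProductSum_eq {q y : ℂ} {t : ℤ → ℂ} (hq : ‖q‖ < 1) (hq0 : q ≠ 0) (hy : y ≠ 0)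
    (ht : ∀ n, t (n + 1) = -(q ^ (n + 1) * y * t n)) (N : ℕ) :
    (∏ i ∈ Finset.range (2 * N + 1), (1 - q ^ (i + 1))) * tripleProductSum q t N =
      (1 - y⁻¹) * t 0 * (∏ i ∈ Finset.range N, (1 - q ^ (i + 1) * y)) *
        ∏ i ∈ Finset.range N, (1 - q ^ (i + 1) * y⁻¹) := by
  induction N with
  | zero =>
    have := one_sub_pow_succ_ne_zero hq 0
    simp only [zero_add, pow_one] at this
    rw [tripleProductSum_zero hy ht]
    simp
    field_simp
  | succ N ih =>
    rw [show 2 * (N + 1) + 1 = 2 * N + 1 + 1 + 1 by ring, Finset.prod_range_succ _ (2 * N + 1 + 1),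
      Finset.prod_range_succ _ (2 * N + 1), Finset.prod_range_succ _ N, Finset.prod_range_succ _ N]
    linear_combination (∏ i ∈ Finset.range (2 * N + 1), (1 - q ^ (i + 1))) *
      tripleProductSum_succ hq hq0 hy ht N +
      (1 - q ^ (N + 1) * y) * (1 - q ^ (N + 1) * y⁻¹) * ih

/-- Tannery's theorem turns the finite identity into Jacobi's triple product identity. -/
lemma exists_tripleProduct {q : ℂ} (hq : ‖q‖ < 1) (hq0 : q ≠ 0) :
    ∃ K : ℂ, ∀ (y : ℂ) (t : ℤ → ℂ), y ≠ 0 → Summable t →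
      (∀ n, t (n + 1) = -(q ^ (n + 1) * y * t n)) →
      K * ∑' n, t n = (1 - y⁻¹) * t 0 * (∏' n : ℕ, (1 - q ^ (n + 1) * y)) *
        ∏' n : ℕ, (1 - q ^ (n + 1) * y⁻¹) := by
  obtain ⟨a, ha⟩ := exists_tendsto_invQPochhammer hq
  obtain ⟨C, hC⟩ := exists_norm_invQPochhammer_le hq
  refine ⟨(∏' n : ℕ, (1 - q ^ (n + 1) * 1)) * (a * a), fun y t hy hs ht ↦ ?_⟩
  have hC0 : 0 ≤ C := (norm_nonneg _).trans (hC 0)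
  have hlim : Tendsto (tripleProductSum q t) atTop (𝓝 (∑' n, a * a * t n)) := by
    refine tendsto_tsum_of_dominated_convergence (bound := fun n ↦ C * C * ‖t n‖)
      (hs.norm.mul_left _) (fun n ↦ ?_) (.of_forall fun N n ↦ ?_)
    · have hcast : Tendsto (fun N : ℕ ↦ (N : ℤ)) atTop atTop := tendsto_natCast_atTop_atTop
      have h₁ : Tendsto (fun N : ℕ ↦ (N : ℤ) - n) atTop atTop :=
        tendsto_atTop_add_const_right _ (-n) hcast
      have h₂ : Tendsto (fun N : ℕ ↦ (N : ℤ) + 1 + n) atTop atTop :=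
        tendsto_atTop_add_const_right _ n (tendsto_atTop_add_const_right _ 1 hcast)
      exact ((ha.comp h₁).mul (ha.comp h₂)).mul_const _
    · rw [norm_mul, norm_mul]
      gcongr <;> exact hC _
  have hprod (u : ℂ) := (multipliable_one_sub_pow_succ_mul hq u).hasProd.tendsto_prod_nat
  have hodd : Tendsto (fun N : ℕ ↦ 2 * N + 1) atTop atTop :=
    tendsto_atTop_mono (fun N ↦ show N ≤ 2 * N + 1 by lia) tendsto_id
  have hleft := ((hprod 1).comp hodd).mul hlim
  rw [tsum_mul_left, ← mul_assoc] at hleft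
  refine tendsto_nhds_unique hleft ((((hprod y).const_mul _).mul (hprod y⁻¹)).congr fun N ↦ ?_)
  simpa using (tripleProductSum_eq hq hq0 hy ht N).symm

lemma multipliableLocallyUniformlyOn_one_sub_pow_succ_mul {q : ℂ} (hq : ‖q‖ < 1) (R : ℝ) :
    MultipliableLocallyUniformlyOn (fun (n : ℕ) (u : ℂ) ↦ 1 - q ^ (n + 1) * u)
      (Metric.ball 0 R) := by
  simp only [sub_eq_add_neg]
  refine Summable.multipliableLocallyUniformlyOn_nat_one_add Metric.isOpen_ball
    (u := fun n ↦ ‖q‖ ^ (n + 1) * R) (((summable_nat_add_iff 1).mpr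
      (summable_geometric_of_lt_one (norm_nonneg _) hq)).mul_right _)
    (.of_forall fun n x hx ↦ ?_) (fun _ ↦ by fun_prop)
  rw [norm_neg, norm_mul, norm_pow]
  gcongr
  simpa using (Metric.mem_ball.1 hx).le

lemma differentiable_tprod_one_sub_pow_succ_mul {q : ℂ} (hq : ‖q‖ < 1) :
    Differentiable ℂ fun u ↦ ∏' n : ℕ, (1 - q ^ (n + 1) * u) := fun u ↦ by
  have hu : u ∈ Metric.ball (0 : ℂ) (‖u‖ + 1) := by simp
  exact ((multipliableLocallyUniformlyOn_one_sub_pow_succ_mul hq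
    (‖u‖ + 1)).hasProdLocallyUniformlyOn.differentiableOn
    (.of_forall fun _ ↦ by simpa [Finset.prod_fn] using
      DifferentiableOn.finsetProd (fun _ _ ↦ by fun_prop)) Metric.isOpen_ball).differentiableAt
    (Metric.isOpen_ball.mem_nhds hu)

lemma hasSum_pow_succ_of_norm_lt_one {x : ℂ} (hx : ‖x‖ < 1) :
    HasSum (fun k : ℕ ↦ x ^ (k + 1)) (x / (1 - x)) := by
  simpa only [pow_succ', div_eq_mul_inv] using (hasSum_geometric_of_norm_lt_one hx).mul_left x

lemma summable_pow_succ_mul_pow_succ {q u : ℂ} (hq : ‖q‖ < 1) (hu : ‖q * u‖ < 1) :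
    Summable fun p : ℕ × ℕ ↦ (q ^ (p.1 + 1) * u) ^ (p.2 + 1) := by
  have h₁ : Summable fun n : ℕ ↦ ‖q‖ ^ n := summable_geometric_of_lt_one (norm_nonneg q) hq
  have h₂ : Summable fun k : ℕ ↦ ‖q * u‖ ^ (k + 1) :=
    (summable_nat_add_iff 1).mpr (summable_geometric_of_lt_one (norm_nonneg _) hu)
  refine (h₁.mul_of_nonneg h₂ (fun n ↦ by positivity) (fun k ↦ by positivity)).of_norm_bounded
    fun p ↦ ?_
  rw [pow_succ q p.1, mul_assoc, mul_pow, norm_mul, norm_pow, norm_pow, norm_pow]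
  gcongr
  exact pow_le_of_le_one (by positivity) (pow_le_one₀ (norm_nonneg q) hq.le) p.2.succ_ne_zero

/-- Both sides are sums of the double series `∑ q ^ ((n + 1) * (k + 1)) * u ^ (k + 1)`. -/
lemma exists_hasSum_lambert {q u : ℂ} (hq : ‖q‖ < 1) (hu : ‖q * u‖ < 1) :
    ∃ S : ℂ, HasSum (fun n : ℕ ↦ q ^ (n + 1) * u / (1 - q ^ (n + 1) * u)) S ∧
      HasSum (fun k : ℕ ↦ q ^ (k + 1) / (1 - q ^ (k + 1)) * u ^ (k + 1)) S := by
  obtain ⟨S, hS⟩ := summable_pow_succ_mul_pow_succ hq hu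
  have hswap : HasSum (fun p : ℕ × ℕ ↦ (q ^ (p.2 + 1) * u) ^ (p.1 + 1)) S := by
    rw [← (Equiv.prodComm ℕ ℕ).hasSum_iff] at hS
    simpa only [Function.comp_def, Equiv.prodComm_apply, Prod.fst_swap, Prod.snd_swap] using hS
  have hrow (n : ℕ) : HasSum (fun k : ℕ ↦ (q ^ (n + 1) * u) ^ (k + 1))
      (q ^ (n + 1) * u / (1 - q ^ (n + 1) * u)) :=
    hasSum_pow_succ_of_norm_lt_one (norm_pow_succ_mul_lt_one hq hu n)
  refine ⟨S, hS.prod_fiberwise hrow, hswap.prod_fiberwise fun k ↦ ?_⟩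
  have hk : ‖q ^ (k + 1)‖ < 1 := by
    rw [norm_pow]
    exact pow_lt_one₀ (norm_nonneg q) hq k.succ_ne_zero
  have hterm (n : ℕ) : (q ^ (n + 1) * u) ^ (k + 1) = (q ^ (k + 1)) ^ (n + 1) * u ^ (k + 1) := by
    rw [mul_pow, pow_right_comm]
  simp only [hterm]
  exact (hasSum_pow_succ_of_norm_lt_one hk).mul_right _

lemma hasSum_logDeriv_tprod_one_sub_pow_succ_mul {q u : ℂ} (hq : ‖q‖ < 1) (hu : ‖q * u‖ < 1) :
    HasSum (fun k : ℕ ↦ q ^ (k + 1) / (1 - q ^ (k + 1)) * u ^ (k + 1))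
      (-(u * logDeriv (fun u ↦ ∏' n : ℕ, (1 - q ^ (n + 1) * u)) u)) := by
  obtain ⟨S, hS, hS'⟩ := exists_hasSum_lambert hq hu
  convert hS'
  have hlog (n : ℕ) : logDeriv (fun u ↦ 1 - q ^ (n + 1) * u) u =
      -(q ^ (n + 1) / (1 - q ^ (n + 1) * u)) := by
    simp [logDeriv_apply, neg_div]
  rcases eq_or_ne u 0 with rfl | hu0
  · simpa using hS.tsum_eq
  have hsum : HasSum (fun n : ℕ ↦ logDeriv (fun u ↦ 1 - q ^ (n + 1) * u) u) (-(u⁻¹ * S)) := by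
    refine (hS.mul_left u⁻¹).neg.congr_fun fun n ↦ ?_
    rw [hlog]
    field_simp
  rw [logDeriv_tprod_eq_tsum (f := fun n u ↦ 1 - q ^ (n + 1) * u)
    Metric.isOpen_ball (show u ∈ Metric.ball (0 : ℂ) (‖u‖ + 1) by simp)
    (fun n ↦ one_sub_ne_zero_of_norm_lt_one (norm_pow_succ_mul_lt_one hq hu n))
    (fun n ↦ by fun_prop) hsum.summable
    (multipliableLocallyUniformlyOn_one_sub_pow_succ_mul hq _)
    (tprod_one_sub_pow_succ_mul_ne_zero hq hu), hsum.tsum_eq]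
  field_simp

lemma two_mul_theta1_term (z τ : ℂ) (n : ℕ) :
    2 * ((-1 : ℂ) ^ n * exp (Real.pi * I * τ * (2 * n + 1) ^ 2 / 4) * sin ((2 * n + 1) * z)) =
      -I * exp (Real.pi * I * τ / 4) * exp (I * z) *
        (jacobiTheta₂_term n (z / Real.pi + 1 / 2 + τ / 2) τ +
          jacobiTheta₂_term (-((n : ℤ) + 1)) (z / Real.pi + 1 / 2 + τ / 2) τ) := by
  have hpi : (Real.pi : ℂ) ≠ 0 := ofReal_ne_zero.2 Real.pi_ne_zero
  have hsign : (-1 : ℂ) ^ n = exp (n * (Real.pi * I)) := by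
    rw [exp_nat_mul, exp_pi_mul_I]
  have hsign' : (-1 : ℂ) ^ n = -exp (-((n + 1) * (Real.pi * I))) := by
    have h : exp (-(((n + 1 : ℕ) : ℂ) * (Real.pi * I))) = (-1) ^ (n + 1) := by
      rw [exp_neg, exp_nat_mul, exp_pi_mul_I, ← inv_pow, inv_neg_one]
    push_cast at h
    rw [h, pow_succ]
    ring
  have hpos_term : (-1) ^ n * exp (Real.pi * I * τ * (2 * n + 1) ^ 2 / 4) *
      exp ((2 * n + 1) * z * I) = exp (Real.pi * I * τ / 4) * exp (I * z) *
        jacobiTheta₂_term n (z / Real.pi + 1 / 2 + τ / 2) τ := by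
    rw [hsign, jacobiTheta₂_term, ← exp_add, ← exp_add, ← exp_add, ← exp_add]
    congr 1
    push_cast
    field_simp
    ring
  have hneg_term : (-1) ^ n * exp (Real.pi * I * τ * (2 * n + 1) ^ 2 / 4) *
      exp (-((2 * n + 1) * z) * I) = -(exp (Real.pi * I * τ / 4) * exp (I * z) *
        jacobiTheta₂_term (-((n : ℤ) + 1)) (z / Real.pi + 1 / 2 + τ / 2) τ) := by
    rw [hsign', jacobiTheta₂_term, neg_mul, neg_mul, ← exp_add, ← exp_add, ← exp_add, ← exp_add]
    congr 2
    push_cast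
    field_simp
    ring
  rw [Complex.sin]
  linear_combination I * hneg_term - I * hpos_term

lemma theta1_eq_tsum_int {τ : ℂ} (hτ : 0 < τ.im) (z : ℂ) :
    theta1 z τ = -I * exp (Real.pi * I * τ / 4) * exp (I * z) *
      ∑' n : ℤ, jacobiTheta₂_term n (z / Real.pi + 1 / 2 + τ / 2) τ := by
  have hs := (summable_jacobiTheta₂_term_iff (z / Real.pi + 1 / 2 + τ / 2) τ).2 hτ
  rw [← hs.hasSum.nat_add_neg_add_one.tsum_eq, theta1, ← tsum_mul_left, ← tsum_mul_left]
  exact tsum_congr (two_mul_theta1_term z τ)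

lemma jacobiTheta₂_term_succ (z τ : ℂ) (n : ℤ) :
    jacobiTheta₂_term (n + 1) (z / Real.pi + 1 / 2 + τ / 2) τ =
      -(exp (2 * Real.pi * I * τ) ^ (n + 1) * exp (2 * I * z) *
        jacobiTheta₂_term n (z / Real.pi + 1 / 2 + τ / 2) τ) := by
  have hpi : (Real.pi : ℂ) ≠ 0 := ofReal_ne_zero.2 Real.pi_ne_zero
  rw [← neg_one_mul, ← exp_pi_mul_I, ← exp_int_mul, jacobiTheta₂_term, jacobiTheta₂_term,
    ← exp_add, ← exp_add, ← exp_add]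
  congr 1
  push_cast
  field_simp
  ring

lemma norm_exp_two_pi_I_mul_lt_one {τ : ℂ} (hτ : 0 < τ.im) :
    ‖exp (2 * Real.pi * I * τ)‖ < 1 := by
  simpa using UpperHalfPlane.norm_exp_two_pi_I_lt_one ⟨τ, hτ⟩

/-- The product formula for `θ₁`, up to normalisation. -/
lemma exists_mul_theta1_eq {τ : ℂ} (hτ : 0 < τ.im) {q : ℂ}
    (hq : q = exp (2 * Real.pi * I * τ)) :
    ∃ K : ℂ, ∀ z : ℂ, K * theta1 z τ = sin z *
      ((∏' n : ℕ, (1 - q ^ (n + 1) * exp (2 * I * z))) *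
        ∏' n : ℕ, (1 - q ^ (n + 1) * exp (-2 * I * z))) := by
  have hq1 : ‖q‖ < 1 := hq ▸ norm_exp_two_pi_I_mul_lt_one hτ
  obtain ⟨K, hK⟩ := exists_tripleProduct hq1 (hq ▸ exp_ne_zero _)
  refine ⟨K / (2 * exp (Real.pi * I * τ / 4)), fun z ↦ ?_⟩
  have h := hK (exp (2 * I * z)) _ (exp_ne_zero _)
    ((summable_jacobiTheta₂_term_iff (z / Real.pi + 1 / 2 + τ / 2) τ).2 hτ)
    (hq ▸ jacobiTheta₂_term_succ z τ)
  have h0 : jacobiTheta₂_term 0 (z / Real.pi + 1 / 2 + τ / 2) τ = 1 := by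
    simp [jacobiTheta₂_term]
  have hinv : (exp (2 * I * z))⁻¹ = exp (-2 * I * z) := by rw [← exp_neg]; ring_nf
  have hsin : exp (I * z) * (1 - exp (-2 * I * z)) = 2 * I * sin z := by
    rw [mul_sub, ← exp_add, Complex.sin]
    ring_nf
    simp
    ring
  rw [h0, hinv, mul_one] at h
  rw [theta1_eq_tsum_int hτ]
  have hE : exp (Real.pi * I * τ / 4) ≠ 0 := exp_ne_zero _
  generalize ∑' n : ℤ, jacobiTheta₂_term n (z / Real.pi + 1 / 2 + τ / 2) τ = T at h ⊢
  generalize ∏' n : ℕ, (1 - q ^ (n + 1) * exp (2 * I * z)) = P at h ⊢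
  generalize ∏' n : ℕ, (1 - q ^ (n + 1) * exp (-2 * I * z)) = P' at h ⊢
  generalize exp (-2 * I * z) = x at h hsin
  field_simp
  linear_combination (-I * exp (I * z)) * h - I * P * P' * hsin - 2 * sin z * P * P' * I_sq

/-- The logarithmic derivative of `sin w * E (exp (2iw)) * E (exp (-2iw))`. -/
lemma logDeriv_sin_mul_comp_exp {E : ℂ → ℂ} (hE : Differentiable ℂ E) {z : ℂ} (hsin : sin z ≠ 0)
    (h₁ : E (exp (2 * I * z)) ≠ 0) (h₂ : E (exp (-2 * I * z)) ≠ 0) :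
    logDeriv (fun w ↦ sin w * (E (exp (2 * I * w)) * E (exp (-2 * I * w)))) z =
      cos z / sin z + 2 * I * (exp (2 * I * z) * logDeriv E (exp (2 * I * z)) -
        exp (-2 * I * z) * logDeriv E (exp (-2 * I * z))) := by
  have hexp (c : ℂ) : logDeriv (fun w ↦ E (exp (c * w))) z =
      c * (exp (c * z) * logDeriv E (exp (c * z))) := by
    have hd : HasDerivAt (fun w ↦ exp (c * w)) (exp (c * z) * c) z := by
      simpa using ((hasDerivAt_id z).const_mul c).cexp
    have := logDeriv_comp (f := E) (hE _) hd.differentiableAt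
    rw [hd.deriv] at this
    rw [show (fun w ↦ E (exp (c * w))) = E ∘ fun w ↦ exp (c * w) from rfl, this]
    ring
  have hd (c : ℂ) : DifferentiableAt ℂ (fun w ↦ E (exp (c * w))) z := by fun_prop
  rw [logDeriv_mul (f := sin) (g := fun w ↦ E (exp (2 * I * w)) * E (exp (-2 * I * w))) z hsin
      (mul_ne_zero h₁ h₂) (by fun_prop) ((hd _).mul (hd _)),
    logDeriv_mul (f := fun w ↦ E (exp (2 * I * w))) (g := fun w ↦ E (exp (-2 * I * w))) z h₁ h₂
      (hd _) (hd _), hexp, hexp, logDeriv_apply, Complex.deriv_sin]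
  ring

lemma norm_mul_exp_lt_one {τ z : ℂ} (h : |z.im| < Real.pi * τ.im) :
    ‖exp (2 * Real.pi * I * τ) * exp (2 * I * z)‖ < 1 := by
  rw [← exp_add, norm_exp, Real.exp_lt_one_iff]
  have := (abs_lt.1 h).1
  simp
  linarith

theorem theta1_log_deriv (τ : ℂ) (hτ : 0 < τ.im)
    (q : ℂ) (hq : q = Complex.exp (2 * Real.pi * Complex.I * τ))
    (z : ℂ) (hz : ∀ m l : ℤ, z ≠ m * Real.pi + l * Real.pi * τ)
    (him : |z.im| < Real.pi * τ.im) :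
    theta1' z τ / theta1 z τ =
      Complex.cos z / Complex.sin z +
        4 * ∑' n : ℕ, q ^ (n + 1) / (1 - q ^ (n + 1)) *
          Complex.sin (2 * (n + 1) * z) := by
  have hq1 : ‖q‖ < 1 := hq ▸ norm_exp_two_pi_I_mul_lt_one hτ
  have hsin : sin z ≠ 0 := by
    rw [sin_ne_zero_iff]
    intro k
    simpa using hz k 0
  have hy : ‖q * exp (2 * I * z)‖ < 1 := hq ▸ norm_mul_exp_lt_one him
  have hy' : ‖q * exp (-2 * I * z)‖ < 1 := by
    have := norm_mul_exp_lt_one (τ := τ) (z := -z) (by simpa using him)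
    rwa [← hq, show 2 * I * -z = -2 * I * z by ring] at this
  obtain ⟨K, hK⟩ := exists_mul_theta1_eq hτ hq
  have hdE := differentiable_tprod_one_sub_pow_succ_mul hq1
  have hE₁ := tprod_one_sub_pow_succ_mul_ne_zero hq1 hy
  have hE₂ := tprod_one_sub_pow_succ_mul_ne_zero hq1 hy'
  have hsum := ((hasSum_logDeriv_tprod_one_sub_pow_succ_mul hq1 hy).sub
    (hasSum_logDeriv_tprod_one_sub_pow_succ_mul hq1 hy')).mul_left (-2 * I)
  obtain ⟨E, hE⟩ : ∃ E : ℂ → ℂ, ∀ u, ∏' n : ℕ, (1 - q ^ (n + 1) * u) = E u := ⟨_, fun _ ↦ rfl⟩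
  simp only [hE] at hK hdE hE₁ hE₂ hsum
  have hK0 : K ≠ 0 := by
    rintro rfl
    have := hK z
    rw [zero_mul] at this
    exact mul_ne_zero hsin (mul_ne_zero hE₁ hE₂) this.symm
  have hterm (n : ℕ) : -2 * I * (q ^ (n + 1) / (1 - q ^ (n + 1)) * exp (2 * I * z) ^ (n + 1) -
      q ^ (n + 1) / (1 - q ^ (n + 1)) * exp (-2 * I * z) ^ (n + 1)) =
      4 * (q ^ (n + 1) / (1 - q ^ (n + 1)) * sin (2 * (n + 1) * z)) := by
    rw [← exp_nat_mul, ← exp_nat_mul, Complex.sin]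
    push_cast
    ring_nf
  simp only [hterm] at hsum
  have htheta : (fun w ↦ theta1 w τ) = fun w ↦ K⁻¹ *
      (sin w * (E (exp (2 * I * w)) * E (exp (-2 * I * w)))) := by
    funext w
    rw [← hK w, inv_mul_cancel_left₀ hK0]
  change logDeriv (fun w ↦ theta1 w τ) z = _
  rw [htheta, logDeriv_const_mul _ _ (inv_ne_zero hK0), logDeriv_sin_mul_comp_exp hdE hsin hE₁ hE₂,
    ← tsum_mul_left, hsum.tsum_eq]
  ring
end
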